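/- For all positive integers r, d, n with 1 ≤ r ≤ n/2, every adaptive (r,d,n)-locally decodable source code c satisfies E[ℓ(c(X^n))] + 1 ≥ ((rd+1)/(4e)) · ( C(n,r)^{1/(rd+1)} − 1 ), where C(n,r) denotes the binomial coefficient n choose r and e is Euler's number. -/

import Mathlib

open Filter MeasureTheory

/-- A binary decision tree: internal nodes probe a (1-indexed) position of the
codeword, leaves output a bit. -/
inductive DTree : Type
  | leaf (b : Bool) : DTree
  | node (pos : ℕ) (lo hi : DTree) : DTree

namespace DTree

/-- Depth of a decision tree. -/
def depth : DTree → ℕ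
  | leaf _ => 0
  | node _ l h => 1 + max l.depth h.depth

/-- All probed positions lie in `{1, …, ℓ}`. -/
def boundedBy (ℓ : ℕ) : DTree → Prop
  | leaf _ => True
  | node p l h => 1 ≤ p ∧ p ≤ ℓ ∧ l.boundedBy ℓ ∧ h.boundedBy ℓ

/-- Evaluate the tree on a codeword `w` (positions are 1-indexed). -/
def eval (w : List Bool) : DTree → Bool
  | leaf b => b
  | node p l h => if w.getD (p - 1) false then h.eval w else l.eval w

end DTree

/-- `x : Fin n → Bool` has exactly `r` ones. -/
def Sparse (n r : ℕ) (x : Fin n → Bool) : Prop :=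
  (Finset.univ.filter fun i => x i = true).card = r

instance (n r : ℕ) : DecidablePred (Sparse n r) := fun _ => Nat.decEq _ r

/-- The type of `r`-sparse binary vectors of length `n`. -/
abbrev SparseVec (n r : ℕ) := {x : Fin n → Bool // Sparse n r x}

/-- An adaptive `(r,d,n)`-locally decodable source code. -/
structure AdaptiveLDC (r d n : ℕ) where
  enc : SparseVec n r → List Bool
  enc_inj : Function.Injective enc
  tree : Fin n → ℕ → DTree
  depth_le : ∀ j ℓ, (tree j ℓ).depth ≤ d
  bounded : ∀ j ℓ, (tree j ℓ).boundedBy ℓ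
  correct : ∀ x (j : Fin n), (tree j (enc x).length).eval (enc x) = x.1 j

/-- Expected codeword length under the uniform distribution on `r`-sparse vectors. -/
noncomputable def expLenA {r d n : ℕ} (c : AdaptiveLDC r d n) : ℝ :=
  (∑ x : SparseVec n r, ((c.enc x).length : ℝ)) / (n.choose r : ℝ)



/-- The monomial `∏_{i ∈ I} w_x(i)` in the codeword bits. -/
def monoFun {X : Type} (w : X → List Bool) (I : Finset ℕ) : X → ℚ :=
  fun x => if ∀ i ∈ I, (w x).getD i false = true then 1 else 0

/-- Span of the monomials of degree at most `D` in the first `l` bits. -/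
def polySpan {X : Type} (w : X → List Bool) (l D : ℕ) : Submodule ℚ (X → ℚ) :=
  Submodule.span ℚ (Set.image (monoFun w) {I | I ⊆ Finset.range l ∧ I.card ≤ D})

lemma polySpan_mono {X : Type} (w : X → List Bool) (l : ℕ) {D E : ℕ} (h : D ≤ E) :
    polySpan w l D ≤ polySpan w l E :=
  Submodule.span_mono (Set.image_mono fun _ hI => ⟨hI.1, hI.2.trans h⟩)

lemma monoFun_mul {X : Type} (w : X → List Bool) (I J : Finset ℕ) :
    monoFun w I * monoFun w J = monoFun w (I ∪ J) := by
  funext x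
  have key : (∀ i ∈ I ∪ J, (w x).getD i false = true) ↔
      (∀ i ∈ I, (w x).getD i false = true) ∧ (∀ i ∈ J, (w x).getD i false = true) := by
    constructor
    · intro h
      exact ⟨fun i hi => h i (Finset.mem_union_left _ hi),
        fun i hi => h i (Finset.mem_union_right _ hi)⟩
    · rintro ⟨h1, h2⟩ i hi
      exact (Finset.mem_union.1 hi).elim (h1 i) (h2 i)
  simp only [monoFun, Pi.mul_apply]
  rw [if_congr key rfl rfl, ite_and, ite_mul, one_mul, zero_mul]

lemma polySpan_mul {X : Type} (w : X → List Bool) (l D E : ℕ) {f g : X → ℚ}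
    (hf : f ∈ polySpan w l D) (hg : g ∈ polySpan w l E) : f * g ∈ polySpan w l (D + E) := by
  have h : f * g ∈ polySpan w l D * polySpan w l E := Submodule.mul_mem_mul hf hg
  unfold polySpan at h
  rw [Submodule.span_mul_span] at h
  refine Submodule.span_mono ?_ h
  rintro _ ⟨_, ⟨I, hI, rfl⟩, _, ⟨J, hJ, rfl⟩, rfl⟩
  refine ⟨I ∪ J, ⟨Finset.union_subset hI.1 hJ.1, ?_⟩, (monoFun_mul w I J).symm⟩
  exact (Finset.card_union_le _ _).trans (Nat.add_le_add hI.2 hJ.2)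

lemma one_mem_polySpan {X : Type} (w : X → List Bool) (l D : ℕ) :
    (1 : X → ℚ) ∈ polySpan w l D := by
  refine Submodule.subset_span ⟨∅, by simp, ?_⟩
  funext x
  simp [monoFun]

lemma prod_mem_polySpan {X ι : Type} (w : X → List Bool) (l d : ℕ) (s : Finset ι)
    (f : ι → X → ℚ) (hf : ∀ i ∈ s, f i ∈ polySpan w l d) :
    (∏ i ∈ s, f i) ∈ polySpan w l (s.card * d) := by
  classical
  induction s using Finset.induction_on with
  | empty => simpa using one_mem_polySpan w l 0
  | insert a s ha ih =>
    rw [Finset.prod_insert ha, Finset.card_insert_of_notMem ha, add_mul, one_mul,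
      add_comm (s.card * d)]
    exact polySpan_mul w l _ _ (hf a (by simp)) (ih fun i hi => hf i (by simp [hi]))

lemma eval_mem_polySpan {X : Type} (w : X → List Bool) (l : ℕ) (t : DTree)
    (ht : t.boundedBy l) :
    (fun x => if t.eval (w x) = true then (1 : ℚ) else 0) ∈ polySpan w l t.depth := by
  induction t with
  | leaf b =>
    cases b
    · simp only [DTree.eval, Bool.false_eq_true, if_false]
      exact (polySpan w l _).zero_mem
    · simp only [DTree.eval, if_true]
      exact one_mem_polySpan w l _
  | node p lo hi ihl ihh =>
    obtain ⟨h1, h2, hl, hh⟩ := ht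
    have hb : monoFun w {p - 1} ∈ polySpan w l 1 :=
      Submodule.subset_span ⟨{p - 1}, ⟨by simp; omega, by simp⟩, rfl⟩
    have hb' : 1 - monoFun w {p - 1} ∈ polySpan w l 1 :=
      Submodule.sub_mem _ (one_mem_polySpan w l 1) hb
    have e1 := polySpan_mul w l _ _ hb
      (polySpan_mono w l (le_max_right lo.depth hi.depth) (ihh hh))
    have e2 := polySpan_mul w l _ _ hb'
      (polySpan_mono w l (le_max_left lo.depth hi.depth) (ihl hl))
    have e3 := Submodule.add_mem _ e1 e2
    have : (fun x => if (DTree.node p lo hi).eval (w x) = true then (1 : ℚ) else 0) =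
        monoFun w {p - 1} * (fun x => if hi.eval (w x) = true then (1 : ℚ) else 0) +
        (1 - monoFun w {p - 1}) * (fun x => if lo.eval (w x) = true then (1 : ℚ) else 0) := by
      funext x
      by_cases hx : (w x).getD (p - 1) false = true
      · simp only [DTree.eval, monoFun, Pi.add_apply, Pi.mul_apply, Pi.sub_apply, Pi.one_apply,
          Finset.mem_singleton, forall_eq, if_pos hx]
        ring
      · simp only [DTree.eval, monoFun, Pi.add_apply, Pi.mul_apply, Pi.sub_apply, Pi.one_apply,
          Finset.mem_singleton, forall_eq, if_neg hx]
        ring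
    rw [this]
    exact e3

lemma finrank_polySpan_le {X : Type} [Fintype X] (w : X → List Bool) (l D : ℕ) :
    Module.finrank ℚ (polySpan w l D) ≤ ∑ i ∈ Finset.range (D + 1), l.choose i := by
  classical
  set F : Finset (X → ℚ) :=
    ((Finset.range (D + 1)).biUnion fun i => (Finset.range l).powersetCard i).image (monoFun w)
    with hF
  have h : polySpan w l D ≤ Submodule.span ℚ (F : Set (X → ℚ)) := by
    refine Submodule.span_mono ?_
    rintro _ ⟨I, ⟨hI, hc⟩, rfl⟩
    simp only [hF, Finset.coe_image]
    refine ⟨I, ?_, rfl⟩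
    simp only [Finset.mem_coe, Finset.mem_biUnion, Finset.mem_range, Finset.mem_powersetCard]
    exact ⟨I.card, by omega, hI, rfl⟩
  calc _ ≤ Module.finrank ℚ (Submodule.span ℚ (F : Set (X → ℚ))) := Submodule.finrank_mono h
    _ ≤ F.card := finrank_span_finset_le_card F
    _ ≤ _ := Finset.card_image_le
    _ ≤ _ := Finset.card_biUnion_le
    _ = _ := by simp

lemma card_len_le {r d n : ℕ} (c : AdaptiveLDC r d n) (l : ℕ) :
    (Finset.univ.filter fun x => (c.enc x).length = l).card ≤
      ∑ i ∈ Finset.range (r * d + 1), l.choose i := by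
  classical
  let X := {x : SparseVec n r // (c.enc x).length = l}
  let w : X → List Bool := fun x => c.enc x.1
  have hcard : (Finset.univ.filter fun x => (c.enc x).length = l).card = Fintype.card X :=
    (Fintype.card_subtype _).symm
  have htop : polySpan w l (r * d) = ⊤ := by
    rw [eq_top_iff, ← (Pi.basisFun ℚ X).span_eq, Submodule.span_le]
    rintro _ ⟨y, rfl⟩
    have hy : (Finset.univ.filter fun i => y.1.1 i = true).card = r := y.1.2
    have hp := prod_mem_polySpan w l d (Finset.univ.filter fun i => y.1.1 i = true)
      (fun j x => if (c.tree j l).eval (w x) = true then (1 : ℚ) else 0)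
      (fun j _ => polySpan_mono w l (c.depth_le j l) (eval_mem_polySpan w l _ (c.bounded j l)))
    rw [hy] at hp
    rw [SetLike.mem_coe]
    convert hp using 1
    funext x
    have hx : ∀ j, (c.tree j l).eval (w x) = x.1.1 j := fun j => by
      have := c.correct x.1 j
      rwa [x.2] at this
    have hxr : (Finset.univ.filter fun i => x.1.1 i = true).card = r := x.1.2
    simp only [Pi.basisFun_apply, Finset.prod_apply, hx]
    by_cases hxy : x = y
    · subst hxy
      rw [Pi.single_eq_same, Finset.prod_eq_one]
      intro j hj
      simp [(Finset.mem_filter.1 hj).2]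
    · rw [Pi.single_eq_of_ne hxy]
      symm
      have : ∃ j ∈ Finset.univ.filter fun i => y.1.1 i = true, x.1.1 j ≠ true := by
        by_contra! hcon
        apply hxy
        have hsub : (Finset.univ.filter fun i => y.1.1 i = true) ⊆
            Finset.univ.filter fun i => x.1.1 i = true := fun j hj => by
          simpa using hcon j hj
        have heq := Finset.eq_of_subset_of_card_le hsub (by rw [hy, hxr])
        apply Subtype.ext
        apply Subtype.ext
        funext j
        have := Finset.ext_iff.1 heq j
        simp only [Finset.mem_filter, Finset.mem_univ, true_and] at this
        rw [Bool.eq_iff_iff]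
        exact this.symm
      obtain ⟨j, hj, hne⟩ := this
      exact Finset.prod_eq_zero hj (by simp [hne])
  have := finrank_polySpan_le w l (r * d)
  rw [htop, finrank_top, Module.finrank_fintype_fun_eq_card] at this
  rw [hcard]
  exact this

lemma card_short_le {r d n : ℕ} (c : AdaptiveLDC r d n) (m : ℕ) :
    (Finset.univ.filter fun x => (c.enc x).length < m).card ≤
      ∑ i ∈ Finset.range (r * d + 1), m.choose (i + 1) := by
  classical
  induction m with
  | zero => simp
  | succ m ih =>
    have hs : (Finset.univ.filter fun x => (c.enc x).length < m + 1) ⊆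
        (Finset.univ.filter fun x => (c.enc x).length < m) ∪
        (Finset.univ.filter fun x => (c.enc x).length = m) := by
      intro x
      simp only [Finset.mem_filter, Finset.mem_union, Finset.mem_univ, true_and]
      omega
    refine (Finset.card_le_card hs).trans ((Finset.card_union_le _ _).trans ?_)
    refine (Nat.add_le_add ih (card_len_le c m)).trans ?_
    rw [← Finset.sum_add_distrib]
    refine Finset.sum_le_sum fun i _ => ?_
    rw [Nat.choose_succ_succ]
    simp only [Nat.succ_eq_add_one]
    omega

lemma pow_mul_factorial_le (k i : ℕ) (h : i ≤ k) :
    k ^ i * i.factorial ≤ k.descFactorial i * i ^ i := by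
  have e1 : (∏ _j ∈ Finset.range i, k) = k ^ i := by simp
  have e2 : (∏ _j ∈ Finset.range i, i) = i ^ i := by simp
  rw [← Nat.descFactorial_self i, Nat.descFactorial_eq_prod_range, Nat.descFactorial_eq_prod_range,
    ← e1, ← e2, ← Finset.prod_mul_distrib, ← Finset.prod_mul_distrib]
  refine Finset.prod_le_prod' fun j hj => ?_
  have hj := Finset.mem_range.1 hj
  obtain ⟨a, rfl⟩ := Nat.exists_eq_add_of_le hj.le
  obtain ⟨b, rfl⟩ := Nat.exists_eq_add_of_le h
  rw [show j + a + b - j = a + b by omega, show j + a - j = a by omega]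
  nlinarith [Nat.zero_le (j * b)]

lemma term_le (k m i : ℕ) (hi : 1 ≤ i) (hik : i ≤ k) :
    2 * (m.choose i : ℝ) ≤ (2 * Real.exp 1 * m / k) ^ i * (k.choose i : ℝ) := by
  have hk : (0 : ℝ) < k := by exact_mod_cast (by omega : 0 < k)
  have hi0 : (0 : ℝ) < i := by exact_mod_cast (by omega : 0 < i)
  have hf : (0 : ℝ) < i.factorial := by exact_mod_cast Nat.factorial_pos i
  have h1 : (m.choose i : ℝ) ≤ (m : ℝ) ^ i / i.factorial := Nat.choose_le_pow_div i m
  have h2 : (i : ℝ) ^ i ≤ Real.exp 1 ^ i * i.factorial := by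
    have := Real.pow_div_factorial_le_exp (i : ℝ) hi0.le i
    rw [div_le_iff₀ hf] at this
    rwa [← Real.exp_nat_mul, mul_one]
  have h3 : (k : ℝ) ^ i ≤ (k.choose i : ℝ) * (i : ℝ) ^ i := by
    have := pow_mul_factorial_le k i hik
    rw [Nat.descFactorial_eq_factorial_mul_choose] at this
    have h : k ^ i ≤ k.choose i * i ^ i := by
      refine Nat.le_of_mul_le_mul_right ?_ (Nat.factorial_pos i)
      calc _ ≤ _ := this
        _ = _ := by ring
    exact_mod_cast h
  have h4 : (2 : ℝ) ≤ 2 ^ i := by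
    calc (2 : ℝ) = 2 ^ 1 := by norm_num
      _ ≤ 2 ^ i := pow_le_pow_right₀ (by norm_num) hi
  have h5 : (k : ℝ) ^ i ≤ (k.choose i : ℝ) * (Real.exp 1 ^ i * i.factorial) :=
    h3.trans (by gcongr)
  have h6 : 1 / (i.factorial : ℝ) ≤ Real.exp 1 ^ i * k.choose i / (k : ℝ) ^ i := by
    rw [div_le_div_iff₀ hf (by positivity)]
    linarith
  calc 2 * (m.choose i : ℝ) ≤ 2 ^ i * ((m : ℝ) ^ i / i.factorial) := by gcongr
    _ = 2 ^ i * (m : ℝ) ^ i * (1 / i.factorial) := by ring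
    _ ≤ 2 ^ i * (m : ℝ) ^ i * (Real.exp 1 ^ i * k.choose i / (k : ℝ) ^ i) := by gcongr
    _ = _ := by rw [div_pow, mul_pow, mul_pow]; ring

lemma sum_le_pow (k m : ℕ) :
    2 * ∑ i ∈ Finset.range k, (m.choose (i + 1) : ℝ) ≤ (2 * Real.exp 1 * m / k + 1) ^ k := by
  rw [add_pow, Finset.sum_range_succ', Finset.mul_sum]
  refine le_add_of_le_of_nonneg (Finset.sum_le_sum fun i hi => ?_) (by positivity)
  have hi := Finset.mem_range.1 hi
  simpa using term_le k m (i + 1) (by omega) (by omega)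

lemma card_sparseVec (n r : ℕ) : Fintype.card (SparseVec n r) = n.choose r := by
  classical
  rw [← Fintype.card_fin n, ← Fintype.card_finset_len, Fintype.card_fin]
  refine Fintype.card_congr
    { toFun := fun x => ⟨Finset.univ.filter fun i => x.1 i = true, x.2⟩
      invFun := fun s => ⟨fun i => decide (i ∈ s.1), ?_⟩
      left_inv := ?_
      right_inv := ?_ }
  · have := s.2
    simpa [Sparse] using this
  · intro x; ext i; simp
  · intro s; ext i; simp

/-- Theorem 1 (converse for adaptive codes): every adaptive `(r,d,n)`-locally decodable
source code satisfies
`E[ℓ(c(Xⁿ))] + 1 ≥ ((rd+1)/(4e)) * (C(n,r)^{1/(rd+1)} − 1)`. -/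
theorem adaptive_lower_bound (r d n : ℕ) (hr : 1 ≤ r) (hd : 1 ≤ d) (hrn : 2 * r ≤ n)
    (c : AdaptiveLDC r d n) :
    expLenA c + 1 ≥
      ((r * d + 1 : ℝ) / (4 * Real.exp 1)) *
        ((n.choose r : ℝ) ^ (1 / (r * d + 1 : ℝ)) - 1) := by
  have hM : 0 < n.choose r := Nat.choose_pos (by omega)
  have hMR : (0 : ℝ) < n.choose r := by exact_mod_cast hM
  have he : 0 < Real.exp 1 := Real.exp_pos 1
  have hE0 : 0 ≤ expLenA c := by unfold expLenA; positivity
  set k : ℕ := r * d + 1 with hk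
  have hkR : (r * d + 1 : ℝ) = (k : ℝ) := by simp [hk]
  have hk0 : (0 : ℝ) < k := by rw [← hkR]; positivity
  rw [hkR]
  set R : ℝ := (n.choose r : ℝ) ^ (1 / (k : ℝ)) with hR
  have hR0 : 0 ≤ R := by positivity
  have hRk : R ^ k = n.choose r := by
    rw [hR, one_div]
    exact Real.rpow_inv_natCast_pow hMR.le (by omega)
  set B : ℝ := k / (2 * Real.exp 1) * (R - 1) with hB
  have hBeq : (k : ℝ) / (4 * Real.exp 1) * (R - 1) = B / 2 := by
    rw [hB]; field_simp; ring
  rw [hBeq]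
  by_cases hB2 : B ≤ 2
  · linarith
  push Not at hB2
  obtain ⟨m, hm⟩ : ∃ m, ⌈B⌉₊ = m + 1 := ⟨⌈B⌉₊ - 1, by
    have := Nat.ceil_pos.2 (by linarith : 0 < B); omega⟩
  have hm1 : B ≤ m + 1 := by
    have := Nat.le_ceil B
    rw [hm] at this
    exact_mod_cast this
  have hm2 : (m : ℝ) < B := Nat.lt_ceil.1 (by omega)
  have hlow : 2 * Real.exp 1 * m / k + 1 ≤ R := by
    have : 2 * Real.exp 1 * m / k ≤ 2 * Real.exp 1 * B / k := by gcongr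
    have h2 : 2 * Real.exp 1 * B / k = R - 1 := by rw [hB]; field_simp
    linarith
  have hcount : 2 * ((Finset.univ.filter fun x => (c.enc x).length < m).card : ℝ) ≤
      n.choose r := by
    have h1 : ((Finset.univ.filter fun x => (c.enc x).length < m).card : ℝ) ≤
        ∑ i ∈ Finset.range k, (m.choose (i + 1) : ℝ) := by
      exact_mod_cast card_short_le c m
    have h2 := sum_le_pow k m
    have h3 : (2 * Real.exp 1 * m / k + 1) ^ k ≤ R ^ k :=
      pow_le_pow_left₀ (by positivity) hlow k
    linarith
  have hsplit : ((Finset.univ.filter fun x => (c.enc x).length < m).card : ℝ) +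
      ((Finset.univ.filter fun x => ¬ (c.enc x).length < m).card : ℝ) = n.choose r := by
    rw [← card_sparseVec n r]
    exact_mod_cast Finset.card_filter_add_card_filter_not (s := Finset.univ)
      (fun x => (c.enc x).length < m)
  have hsum : ((Finset.univ.filter fun x => ¬ (c.enc x).length < m).card : ℝ) * m ≤
      ∑ x : SparseVec n r, ((c.enc x).length : ℝ) := by
    rw [← nsmul_eq_mul]
    refine (Finset.card_nsmul_le_sum _ (fun x => ((c.enc x).length : ℝ)) _ ?_).trans
      (Finset.sum_le_sum_of_subset_of_nonneg (Finset.filter_subset _ _)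
        fun _ _ _ => by positivity)
    intro x hx
    have := (Finset.mem_filter.1 hx).2
    exact_mod_cast not_lt.1 this
  have hE : (m : ℝ) / 2 ≤ expLenA c := by
    unfold expLenA
    rw [le_div_iff₀ hMR]
    refine le_trans ?_ hsum
    have h : (n.choose r : ℝ) / 2 ≤
        ((Finset.univ.filter fun x => ¬ (c.enc x).length < m).card : ℝ) := by linarith
    have := mul_le_mul_of_nonneg_right h (Nat.cast_nonneg (α := ℝ) m)
    linarith
  linarith
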